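/- Let 0 < α < 1 and define the varying relaxation coefficient r_α(t) = t^{α-1} E_{α,α}(-t^α) / E_α(-t^α) for t > 0. Then for every t ≥ 0, E_α(-t^α) = exp(-∫₀ᵗ r_α(s) ds), where the integral converges (r_α is integrable on (0, t) despite the singularity s^{α-1} at the origin). -/

import Mathlib

/-- The one-parameter Mittag-Leffler function `E_α(x) = ∑ xⁿ / Γ(αn + 1)`. -/
noncomputable def mittagLeffler (α x : ℝ) : ℝ :=
  ∑' n : ℕ, x ^ n / Real.Gamma (α * n + 1)

/-- The two-parameter Mittag-Leffler function `E_{α,β}(x) = ∑ xⁿ / Γ(αn + β)`. -/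
noncomputable def mittagLeffler2 (α β x : ℝ) : ℝ :=
  ∑' n : ℕ, x ^ n / Real.Gamma (α * n + β)

open MeasureTheory Set in
/-- The lower bound `R ^ (y - 1) * exp (-R) ≤ Γ(y)` for `y ≥ 1`. -/
lemma rpow_mul_exp_neg_le_Gamma {R y : ℝ} (hR : 0 < R) (hy : 1 ≤ y) :
    R ^ (y - 1) * Real.exp (-R) ≤ Real.Gamma y := by
  have hconv := Real.GammaIntegral_convergent (s := y) (by linarith)
  have hsub : Ioi R ⊆ Ioi 0 := Ioi_subset_Ioi hR.le
  rw [Real.Gamma_eq_integral (by linarith), ← integral_exp_neg_Ioi, ← integral_const_mul]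
  calc ∫ x in Ioi R, R ^ (y - 1) * Real.exp (-x)
      ≤ ∫ x in Ioi R, Real.exp (-x) * x ^ (y - 1) := by
        refine setIntegral_mono_on ?_ (hconv.mono_set hsub) measurableSet_Ioi fun x hx => ?_
        · exact (integrableOn_exp_neg_Ioi R).const_mul _
        · rw [mul_comm]
          have hx' : R ≤ x := le_of_lt hx
          gcongr
    _ ≤ ∫ x in Ioi 0, Real.exp (-x) * x ^ (y - 1) := by
        refine setIntegral_mono_set hconv ?_ hsub.eventuallyLE
        filter_upwards [ae_restrict_mem measurableSet_Ioi] with x hx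
        have : (0 : ℝ) < x := hx
        positivity

lemma summable_pow_div_Gamma {α : ℝ} (hα : 0 < α) {x : ℝ} (hx : 0 ≤ x) :
    Summable fun n : ℕ => x ^ n / Real.Gamma (α * n + 1) := by
  set q : ℝ := x / (x + 1)
  have hq : q < 1 := (div_lt_one (by positivity)).2 (by linarith)
  set R : ℝ := (x + 1) ^ α⁻¹
  have hR : 0 < R := by positivity
  refine Summable.of_nonneg_of_le (fun n => ?_) (fun n => ?_)
    ((summable_geometric_of_lt_one (by positivity) hq).mul_left (Real.exp R))
  · have := Real.Gamma_pos_of_pos (s := α * n + 1) (by positivity)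
    positivity
  · have h := rpow_mul_exp_neg_le_Gamma hR (y := α * n + 1)
      (le_add_of_nonneg_left (by positivity))
    have hpow : R ^ (α * n + 1 - 1) = (x + 1) ^ n := by
      rw [add_sub_cancel_right, ← Real.rpow_mul (by positivity), inv_mul_cancel_left₀ hα.ne',
        Real.rpow_natCast]
    rw [hpow] at h
    calc x ^ n / Real.Gamma (α * n + 1) ≤ x ^ n / ((x + 1) ^ n * Real.exp (-R)) := by gcongr
      _ = Real.exp R * q ^ n := by
        rw [Real.exp_neg, div_pow]
        field_simp

/-- A power series that converges absolutely everywhere can be differentiated termwise. -/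
lemma hasDerivAt_tsum_mul_pow {c : ℕ → ℝ} (hc : ∀ R : ℝ, 0 ≤ R → Summable fun n => |c n| * R ^ n)
    (x : ℝ) :
    HasDerivAt (fun y => ∑' n, c n * y ^ n) (∑' n, c (n + 1) * (n + 1) * x ^ n) x := by
  set R : ℝ := |x| + 1
  have hbound : ∀ (n : ℕ) (y : ℝ), y ∈ Metric.ball (0 : ℝ) R →
      ‖c n * (n * y ^ (n - 1))‖ ≤ |c n| * (2 * R) ^ n := by
    intro n y hy
    have hy' : |y| ≤ R := by simpa using (Metric.mem_ball.1 hy).le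
    have hR : 1 ≤ R := by simp [R]
    rw [norm_mul, norm_mul, norm_pow, Real.norm_eq_abs, Real.norm_natCast, Real.norm_eq_abs,
      mul_pow]
    gcongr
    · exact_mod_cast n.lt_two_pow_self.le
    · calc |y| ^ (n - 1) ≤ R ^ (n - 1) := by gcongr
        _ ≤ R ^ n := pow_le_pow_right₀ hR (Nat.sub_le _ _)
  have hs := hc (2 * R) (by positivity)
  have hx : x ∈ Metric.ball (0 : ℝ) R := by simp [R]
  have hderiv := hasDerivAt_tsum_of_isPreconnected hs Metric.isOpen_ball
    (convex_ball (0 : ℝ) R).isPreconnected (g := fun n y => c n * y ^ n)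
    (fun n y _ => (hasDerivAt_pow n y).const_mul (c n)) hbound hx
    (by
      refine Summable.of_norm ?_
      simpa using hc |x| (abs_nonneg x)) hx
  rw [(Summable.of_norm_bounded hs fun n => hbound n x hx).tsum_eq_zero_add] at hderiv
  simpa [mul_assoc] using hderiv

lemma summable_abs_inv_Gamma_mul_pow {α : ℝ} (hα : 0 < α) {R : ℝ} (hR : 0 ≤ R) :
    Summable fun n : ℕ => |(Real.Gamma (α * n + 1))⁻¹| * R ^ n := by
  refine (summable_pow_div_Gamma hα hR).congr fun n => ?_
  have := Real.Gamma_pos_of_pos (s := α * n + 1) (by positivity)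
  rw [abs_of_nonneg (by positivity), div_eq_inv_mul]

lemma inv_Gamma_succ_mul {α : ℝ} (hα : 0 < α) (n : ℕ) :
    (Real.Gamma (α * (n + 1 : ℕ) + 1))⁻¹ * (n + 1) = α⁻¹ * (Real.Gamma (α * n + α))⁻¹ := by
  have := Real.Gamma_pos_of_pos (s := α * n + α) (by positivity)
  have h : α * ((n + 1 : ℕ) : ℝ) = α * n + α := by push_cast; ring
  rw [h, Real.Gamma_add_one (by positivity)]
  field_simp

/-- The derivative of `E_α` is `α⁻¹ E_{α,α}`. -/
lemma hasDerivAt_mittagLeffler {α : ℝ} (hα : 0 < α) (x : ℝ) :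
    HasDerivAt (mittagLeffler α) (α⁻¹ * mittagLeffler2 α α x) x := by
  have h := hasDerivAt_tsum_mul_pow (fun R hR => summable_abs_inv_Gamma_mul_pow hα hR) x
  simp_rw [inv_Gamma_succ_mul hα, mul_assoc, tsum_mul_left] at h
  have hE : mittagLeffler α = fun y => ∑' n : ℕ, (Real.Gamma (α * n + 1))⁻¹ * y ^ n := by
    funext y
    simp only [mittagLeffler, div_eq_inv_mul]
  rw [hE]
  simpa only [mittagLeffler2, div_eq_inv_mul] using h

lemma continuous_mittagLeffler {α : ℝ} (hα : 0 < α) : Continuous (mittagLeffler α) :=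
  continuous_iff_continuousAt.2 fun x => (hasDerivAt_mittagLeffler hα x).continuousAt

lemma continuous_mittagLeffler2_self {α : ℝ} (hα : 0 < α) :
    Continuous (mittagLeffler2 α α) := by
  refine continuous_iff_continuousAt.2 fun x => ?_
  have hs : ∀ R : ℝ, 0 ≤ R → Summable fun n : ℕ => |(Real.Gamma (α * n + α))⁻¹| * R ^ n := by
    intro R hR
    have h := (summable_nat_add_iff 1).2
      (summable_abs_inv_Gamma_mul_pow hα (R := 2 * (R + 1)) (by positivity))
    refine Summable.of_nonneg_of_le (fun n => by positivity) (fun n => ?_) (h.mul_left α)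
    have hG := inv_Gamma_succ_mul hα n
    have h1 : (Real.Gamma (α * n + α))⁻¹
        = α * ((Real.Gamma (α * (n + 1 : ℕ) + 1))⁻¹ * (n + 1)) := by
      rw [hG, mul_inv_cancel_left₀ hα.ne']
    have h2 : ((n : ℝ) + 1) * R ^ n ≤ (2 * (R + 1)) ^ (n + 1) := by
      rw [mul_pow]
      gcongr
      · exact_mod_cast (n + 1).lt_two_pow_self.le
      · calc R ^ n ≤ (R + 1) ^ n := by gcongr; linarith
          _ ≤ (R + 1) ^ (n + 1) := pow_le_pow_right₀ (by linarith) (Nat.le_succ n)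
    rw [h1, abs_mul, abs_mul, abs_of_pos hα, abs_of_pos (by positivity : (0 : ℝ) < n + 1),
      mul_assoc, mul_assoc]
    gcongr
  have h := (hasDerivAt_tsum_mul_pow hs x).continuousAt
  have hE : mittagLeffler2 α α = fun y => ∑' n : ℕ, (Real.Gamma (α * n + α))⁻¹ * y ^ n := by
    funext y
    simp only [mittagLeffler2, div_eq_inv_mul]
  rwa [hE]

@[simp] lemma mittagLeffler_zero (α : ℝ) : mittagLeffler α 0 = 1 := by
  rw [mittagLeffler, tsum_eq_single 0 fun n hn => by simp [hn]]
  simp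

lemma continuous_mittagLeffler_neg_rpow {α : ℝ} (hα : 0 < α) :
    Continuous fun t : ℝ => mittagLeffler α (-(t ^ α)) :=
  (continuous_mittagLeffler hα).comp (Real.continuous_rpow_const hα.le).neg

/-- The Beta integral over `[0, t]` in terms of the Gamma function. -/
lemma integral_sub_rpow_mul_rpow {a b t : ℝ} (ha : 0 < a) (hb : 0 < b) (ht : 0 < t) :
    ∫ s in (0 : ℝ)..t, (t - s) ^ (a - 1) * s ^ (b - 1)
      = t ^ (a + b - 1) * (Real.Gamma a * Real.Gamma b / Real.Gamma (a + b)) := by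
  have h := Complex.betaIntegral_scaled (b : ℂ) (a : ℂ) ht
  rw [Complex.betaIntegral_eq_Gamma_mul_div _ _ (by simpa) (by simpa)] at h
  have hcongr : ∫ s in (0 : ℝ)..t, (s : ℂ) ^ ((b : ℂ) - 1) * ((t : ℂ) - s) ^ ((a : ℂ) - 1)
      = ∫ s in (0 : ℝ)..t, (((t - s) ^ (a - 1) * s ^ (b - 1) : ℝ) : ℂ) := by
    refine intervalIntegral.integral_congr fun s hs => ?_
    rw [Set.uIcc_of_le ht.le] at hs
    have h1 := hs.1
    have h2 : 0 ≤ t - s := sub_nonneg.2 hs.2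
    rw [Complex.ofReal_mul, Complex.ofReal_cpow h1, Complex.ofReal_cpow h2]
    push_cast
    ring
  rw [hcongr, intervalIntegral.integral_ofReal, ← Complex.ofReal_add, Complex.Gamma_ofReal,
    Complex.Gamma_ofReal, Complex.Gamma_ofReal, ← Complex.ofReal_one, ← Complex.ofReal_sub,
    ← Complex.ofReal_cpow ht.le] at h
  have h' : ∫ s in (0 : ℝ)..t, (t - s) ^ (a - 1) * s ^ (b - 1)
      = t ^ (b + a - 1) * (Real.Gamma b * Real.Gamma a / Real.Gamma (b + a)) := by
    exact_mod_cast h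
  rw [h', add_comm b a, mul_comm (Real.Gamma b)]

lemma intervalIntegrable_sub_rpow {α : ℝ} (hα : 0 < α) (t a b : ℝ) :
    IntervalIntegrable (fun s : ℝ => (t - s) ^ (α - 1)) MeasureTheory.volume a b := by
  have h := (intervalIntegral.intervalIntegrable_rpow' (r := α - 1) (a := t - a) (b := t - b)
    (by linarith)).comp_sub_left t
  simpa using h

/-- The Volterra equation of fractional relaxation:
`E_α(-t^α) = 1 - Γ(α)⁻¹ ∫₀ᵗ (t - s)^(α-1) E_α(-s^α) ds`. -/
lemma mittagLeffler_neg_rpow_add_integral {α : ℝ} (hα : 0 < α) {t : ℝ} (ht : 0 < t) :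
    mittagLeffler α (-(t ^ α))
      + (Real.Gamma α)⁻¹ * ∫ s in (0 : ℝ)..t, (t - s) ^ (α - 1) * mittagLeffler α (-(s ^ α))
      = 1 := by
  have hΓα := Real.Gamma_pos_of_pos hα
  have hΓ : ∀ n : ℕ, 0 < Real.Gamma (α * n + 1) := fun n => Real.Gamma_pos_of_pos (by positivity)
  have hsum : ∀ s : ℝ, 0 ≤ s →
      Summable fun n : ℕ => (-(s ^ α)) ^ n / Real.Gamma (α * n + 1) := by
    intro s hs
    refine Summable.of_norm ((summable_pow_div_Gamma hα (x := s ^ α) (by positivity)).congr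
      fun n => ?_)
    rw [norm_div, norm_pow, norm_neg, Real.norm_of_nonneg (by positivity),
      Real.norm_of_nonneg (hΓ n).le]
  have hswap := intervalIntegral.hasSum_integral_of_dominated_convergence
    (μ := MeasureTheory.volume) (a := 0) (b := t)
    (F := fun (n : ℕ) s => (t - s) ^ (α - 1) * ((-(s ^ α)) ^ n / Real.Gamma (α * n + 1)))
    (f := fun s => (t - s) ^ (α - 1) * mittagLeffler α (-(s ^ α)))
    (fun n s => (t - s) ^ (α - 1) * ((t ^ α) ^ n / Real.Gamma (α * n + 1)))
    (fun n => by
      refine Measurable.aestronglyMeasurable ?_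
      fun_prop)
    (fun n => Filter.Eventually.of_forall fun s hs => by
      rw [Set.uIoc_of_le ht.le] at hs
      have h1 := hs.1
      have h2 : 0 ≤ t - s := sub_nonneg.2 hs.2
      have h3 := hΓ n
      rw [norm_mul, norm_div, norm_pow, norm_neg, Real.norm_of_nonneg (by positivity),
        Real.norm_of_nonneg (by positivity), Real.norm_of_nonneg h3.le]
      have h4 := hs.2
      gcongr)
    (Filter.Eventually.of_forall fun s _ =>
      (summable_pow_div_Gamma hα (by positivity)).mul_left _)
    (by
      simp_rw [tsum_mul_left]
      exact (intervalIntegrable_sub_rpow hα t 0 t).mul_const _)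
    (Filter.Eventually.of_forall fun s hs => by
      rw [Set.uIoc_of_le ht.le] at hs
      exact ((hsum s hs.1.le).hasSum).mul_left _)
  have hterm : ∀ n : ℕ, (Real.Gamma α)⁻¹ *
      (∫ s in (0 : ℝ)..t, (t - s) ^ (α - 1) * ((-(s ^ α)) ^ n / Real.Gamma (α * n + 1)))
      = -((-(t ^ α)) ^ (n + 1) / Real.Gamma (α * (n + 1 : ℕ) + 1)) := by
    intro n
    have hbeta := integral_sub_rpow_mul_rpow hα (b := α * n + 1) (by positivity) ht
    have hcongr : ∫ s in (0 : ℝ)..t, (t - s) ^ (α - 1) * ((-(s ^ α)) ^ n / Real.Gamma (α * n + 1))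
        = ∫ s in (0 : ℝ)..t, ((-1) ^ n / Real.Gamma (α * n + 1)) *
          ((t - s) ^ (α - 1) * s ^ (α * n + 1 - 1)) := by
      refine intervalIntegral.integral_congr fun s hs => ?_
      rw [Set.uIcc_of_le ht.le] at hs
      rw [add_sub_cancel_right, Real.rpow_mul hs.1, Real.rpow_natCast, neg_pow]
      ring
    have hpow : t ^ (α + (α * n + 1) - 1) = (t ^ α) ^ (n + 1) := by
      rw [← Real.rpow_natCast, ← Real.rpow_mul ht.le]
      congr 1
      push_cast
      ring
    have harg : α * ((n + 1 : ℕ) : ℝ) + 1 = α + (α * n + 1) := by push_cast; ring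
    rw [hcongr, intervalIntegral.integral_const_mul, hbeta, hpow, harg, neg_pow (t ^ α)]
    have h3 := hΓ n
    field_simp
    ring
  have hint := (hswap.mul_left (Real.Gamma α)⁻¹).tsum_eq
  simp_rw [hterm] at hint
  rw [← hint, tsum_neg, mittagLeffler, (hsum t ht.le).tsum_eq_zero_add]
  simp

open Set in
/-- If the relaxation function is positive on `[0, t₀)`, then it does not vanish at `t₀`. -/
lemma mittagLeffler_neg_rpow_ne_zero_of_forall_pos {α : ℝ} (hα0 : 0 < α) (hα1 : α < 1) {t₀ : ℝ}
    (ht₀ : 0 < t₀) (hpos : ∀ t, 0 ≤ t → t < t₀ → 0 < mittagLeffler α (-(t ^ α))) :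
    mittagLeffler α (-(t₀ ^ α)) ≠ 0 := by
  intro hzero
  set u : ℝ → ℝ := fun t => mittagLeffler α (-(t ^ α)) with hu
  have hucont : Continuous u := continuous_mittagLeffler_neg_rpow hα0
  have hΓα := Real.Gamma_pos_of_pos hα0
  have hnonneg : ∀ t, 0 ≤ t → t ≤ t₀ → 0 ≤ u t := by
    intro t h0 h1
    rcases h1.lt_or_eq with h | rfl
    · exact (hpos t h0 h).le
    · exact hzero.ge
  have hinteg : ∀ t a b, IntervalIntegrable (fun s => (t - s) ^ (α - 1) * u s)
      MeasureTheory.volume a b := fun t a b =>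
    (intervalIntegrable_sub_rpow hα0 t a b).mul_continuousOn hucont.continuousOn
  obtain ⟨a, ha0, hat, ha⟩ : ∃ a, 0 ≤ a ∧ a < t₀ ∧
      (Real.Gamma α)⁻¹ * ((t₀ - a) ^ α / α) < 1 := by
    have hlim : Filter.Tendsto (fun a : ℝ => (Real.Gamma α)⁻¹ * ((t₀ - a) ^ α / α))
        (nhdsWithin t₀ (Iio t₀)) (nhds 0) := by
      have hc : Continuous fun a : ℝ => (Real.Gamma α)⁻¹ * ((t₀ - a) ^ α / α) := by
        have := (Real.continuous_rpow_const hα0.le).comp (continuous_const.sub continuous_id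
          : Continuous fun a : ℝ => t₀ - a)
        exact continuous_const.mul (this.div_const α)
      have := (hc.tendsto t₀).mono_left (nhdsWithin_le_nhds (s := Iio t₀))
      simpa [Real.zero_rpow hα0.ne'] using this
    obtain ⟨a, ⟨h1, h2⟩, h3⟩ := ((hlim.eventually (gt_mem_nhds one_pos)).and
      (Ico_mem_nhdsLT ht₀)).exists |>.imp fun a h => And.symm h
    exact ⟨a, h1, h2, h3⟩
  obtain ⟨t, ⟨hat', htt₀⟩, hmax⟩ :=
    isCompact_Icc.exists_isMaxOn (nonempty_Icc.2 hat.le) hucont.continuousOn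
  have hut : 0 < u t :=
    (hpos a ha0 hat).trans_le (hmax (left_mem_Icc.2 hat.le))
  have ht0 : 0 ≤ t := ha0.trans hat'
  have hlt : t < t₀ := htt₀.lt_of_ne (by rintro rfl; exact hut.ne' hzero)
  have hV₀ := mittagLeffler_neg_rpow_add_integral hα0 ht₀
  have hV : u t + (Real.Gamma α)⁻¹ * ∫ s in (0 : ℝ)..t, (t - s) ^ (α - 1) * u s = 1 := by
    rcases ht0.eq_or_lt with rfl | h
    · simp [hu, Real.zero_rpow hα0.ne']
    · exact mittagLeffler_neg_rpow_add_integral hα0 h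
  rw [hzero, zero_add, ← intervalIntegral.integral_add_adjacent_intervals
    (hinteg t₀ 0 t) (hinteg t₀ t t₀)] at hV₀
  have hleft : ∫ s in (0 : ℝ)..t, (t₀ - s) ^ (α - 1) * u s
      ≤ ∫ s in (0 : ℝ)..t, (t - s) ^ (α - 1) * u s := by
    refine intervalIntegral.integral_mono_on_of_le_Ioo ht0 (hinteg _ _ _) (hinteg _ _ _)
      fun s hs => ?_
    refine mul_le_mul_of_nonneg_right ?_ (hnonneg s hs.1.le (hs.2.trans hlt).le)
    exact Real.rpow_le_rpow_of_nonpos (sub_pos.2 hs.2) (by linarith) (by linarith)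
  have hright : ∫ s in t..t₀, (t₀ - s) ^ (α - 1) * u s ≤ ((t₀ - a) ^ α / α) * u t := by
    calc ∫ s in t..t₀, (t₀ - s) ^ (α - 1) * u s
        ≤ ∫ s in t..t₀, (t₀ - s) ^ (α - 1) * u t := by
          refine intervalIntegral.integral_mono_on_of_le_Ioo hlt.le (hinteg _ _ _)
            ((intervalIntegrable_sub_rpow hα0 _ _ _).mul_const _) fun s hs => ?_
          have : 0 ≤ t₀ - s := sub_nonneg.2 hs.2.le
          exact mul_le_mul_of_nonneg_left (hmax ⟨hat'.trans hs.1.le, hs.2.le⟩) (by positivity)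
      _ = ((t₀ - t) ^ α / α) * u t := by
          rw [intervalIntegral.integral_mul_const,
            intervalIntegral.integral_comp_sub_left (fun s => s ^ (α - 1)),
            integral_rpow (Or.inl (by linarith))]
          simp [Real.zero_rpow hα0.ne']
      _ ≤ ((t₀ - a) ^ α / α) * u t := by
          have : 0 ≤ t₀ - t := sub_nonneg.2 htt₀
          gcongr
  have hmul : (Real.Gamma α)⁻¹ * (∫ s in (0 : ℝ)..t, (t₀ - s) ^ (α - 1) * u s)
      ≤ (Real.Gamma α)⁻¹ * ∫ s in (0 : ℝ)..t, (t - s) ^ (α - 1) * u s := by gcongr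
  have hmul' : (Real.Gamma α)⁻¹ * (∫ s in t..t₀, (t₀ - s) ^ (α - 1) * u s)
      ≤ (Real.Gamma α)⁻¹ * (((t₀ - a) ^ α / α) * u t) := by gcongr
  rw [← mul_assoc] at hmul'
  have hcontr := mul_lt_mul_of_pos_right ha hut
  change (Real.Gamma α)⁻¹ * ((∫ s in (0 : ℝ)..t, (t₀ - s) ^ (α - 1) * u s)
    + ∫ s in t..t₀, (t₀ - s) ^ (α - 1) * u s) = 1 at hV₀
  rw [mul_add] at hV₀
  linarith

open Set in
lemma mittagLeffler_neg_rpow_pos {α : ℝ} (hα0 : 0 < α) (hα1 : α < 1) {t : ℝ} (ht : 0 ≤ t) :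
    0 < mittagLeffler α (-(t ^ α)) := by
  by_contra! hneg
  have hcont := continuous_mittagLeffler_neg_rpow hα0
  have hzero : mittagLeffler α (-((0 : ℝ) ^ α)) = 1 := by simp [Real.zero_rpow hα0.ne']
  obtain ⟨T, ⟨hT0, hT⟩, hmin⟩ := (isCompact_Icc.inter_right
    (isClosed_Iic.preimage hcont (t := Iic 0))).exists_isLeast ⟨t, ⟨ht, le_rfl⟩, hneg⟩
  have hbefore : ∀ s, 0 ≤ s → s < T → 0 < mittagLeffler α (-(s ^ α)) := by
    intro s hs hsT
    by_contra! h
    exact hsT.not_ge (hmin ⟨⟨hs, hsT.le.trans hT0.2⟩, h⟩)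
  have hTpos : 0 < T := by
    refine hT0.1.lt_of_ne ?_
    rintro rfl
    rw [mem_preimage, hzero, mem_Iic] at hT
    linarith
  refine mittagLeffler_neg_rpow_ne_zero_of_forall_pos hα0 hα1 hTpos hbefore (le_antisymm hT ?_)
  refine ge_of_tendsto ((hcont.tendsto T).mono_left (nhdsWithin_le_nhds (s := Iio T))) ?_
  filter_upwards [Ico_mem_nhdsLT hTpos] with s hs
  exact (hbefore s hs.1 hs.2).le

/-- For `0 < α < 1` and the varying relaxation coefficient
`r_α(t) = t^(α-1) E_{α,α}(-t^α) / E_α(-t^α)`, the coefficient is integrable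
on `(0, t)` (despite the singularity at `0`) and
`E_α(-t^α) = exp(-∫₀ᵗ r_α(s) ds)` for every `t ≥ 0`. -/
theorem mittagLeffler_eq_exp_neg_integral
    (α : ℝ) (hα0 : 0 < α) (hα1 : α < 1)
    (r : ℝ → ℝ)
    (hr : ∀ t, r t = t ^ (α - 1) * mittagLeffler2 α α (-(t ^ α))
                       / mittagLeffler α (-(t ^ α))) :
    ∀ t : ℝ, 0 ≤ t →
      IntervalIntegrable r MeasureTheory.volume 0 t ∧
      mittagLeffler α (-(t ^ α)) = Real.exp (-(∫ s in (0:ℝ)..t, r s)) := by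
  intro t ht
  have hpos : ∀ s : ℝ, 0 ≤ s → 0 < mittagLeffler α (-(s ^ α)) :=
    fun s hs => mittagLeffler_neg_rpow_pos hα0 hα1 hs
  have hint : IntervalIntegrable r MeasureTheory.volume 0 t := by
    have hcont : ContinuousOn
        (fun s : ℝ => mittagLeffler2 α α (-(s ^ α)) / mittagLeffler α (-(s ^ α)))
        (Set.uIcc 0 t) := by
      refine ContinuousOn.div ?_ (continuous_mittagLeffler_neg_rpow hα0).continuousOn
        fun s hs => ?_
      · exact ((continuous_mittagLeffler2_self hα0).comp
          (Real.continuous_rpow_const hα0.le).neg).continuousOn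
      · rw [Set.uIcc_of_le ht] at hs
        exact (hpos s hs.1).ne'
    have h := (intervalIntegral.intervalIntegrable_rpow' (r := α - 1) (a := 0) (b := t)
      (by linarith)).mul_continuousOn hcont
    convert h using 2 with s
    rw [hr, mul_div_assoc]
  refine ⟨hint, ?_⟩
  have hFTC := intervalIntegral.integral_eq_sub_of_hasDerivAt_of_le ht
    (f := fun s => -Real.log (mittagLeffler α (-(s ^ α)))) (f' := r)
    ((continuous_mittagLeffler_neg_rpow hα0).continuousOn.log
      fun s hs => (hpos s hs.1).ne').neg
    (fun s hs => by
      have hu : HasDerivAt (fun s : ℝ => mittagLeffler α (-(s ^ α)))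
          (α⁻¹ * mittagLeffler2 α α (-(s ^ α)) * -(α * s ^ (α - 1))) s :=
        (hasDerivAt_mittagLeffler hα0 (-(s ^ α))).comp (h := fun s : ℝ => -(s ^ α)) s
          (Real.hasDerivAt_rpow_const (p := α) (Or.inl hs.1.ne')).neg
      refine (hu.log (hpos s hs.1.le).ne').neg.congr_deriv ?_
      rw [hr]
      field_simp)
    hint
  rw [hFTC]
  simp [Real.zero_rpow hα0.ne', Real.exp_log (hpos t ht)]
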